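/- For any two distinct vertices u,v of P set X_{u,v} = ∑_{α ∈ 𝒫_T(u,v)} x(α) ∈ F. Then for any four vertices p, q, r, s of P occurring in this cyclic order around P, the Ptolemy relation X_{p,r} · X_{q,s} = X_{p,q} · X_{r,s} + X_{q,r} · X_{p,s} holds in F. (This expresses that the sums X_{u,v} realize the cluster variables and coefficients of the Ptolemy cluster algebra, as asserted in Theorem 1.) -/

import Mathlib

open scoped BigOperators Classical

noncomputable section

/-- The `k`-th vertex of the regular `(n+3)`-gon inscribed in the unit circle. -/
def vtx (n : ℕ) (k : Fin (n + 3)) : EuclideanSpace ℝ (Fin 2) :=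
  (WithLp.equiv 2 (Fin 2 → ℝ)).symm
    ![Real.cos (2 * Real.pi * k / (n + 3)), Real.sin (2 * Real.pi * k / (n + 3))]

/-- `u` and `v` are cyclically adjacent vertices of the `(n+3)`-gon. -/
def Adj (n : ℕ) (u v : Fin (n + 3)) : Prop :=
  (u.val + 1) % (n + 3) = v.val ∨ (v.val + 1) % (n + 3) = u.val

/-- The pair `(u, v)` is a diagonal of the polygon. -/
def IsDiag (n : ℕ) (u v : Fin (n + 3)) : Prop :=
  u ≠ v ∧ ¬ Adj n u v

/-- The open segments joining `u,v` and `w,z` intersect (the two edges cross). -/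
def Cross (n : ℕ) (u v w z : Fin (n + 3)) : Prop :=
  (openSegment ℝ (vtx n u) (vtx n v) ∩ openSegment ℝ (vtx n w) (vtx n z)).Nonempty

/-- `(u,v)` and `(w,z)` are the same unordered pair of vertices. -/
def SamePair (n : ℕ) (u v w z : Fin (n + 3)) : Prop :=
  (u = w ∧ v = z) ∨ (u = z ∧ v = w)

/-- A triangulation of the `(n+3)`-gon: `2n+3` edges, the first `n` of which are
pairwise noncrossing diagonals (a maximal such family), and the remaining `n+3`
are the boundary edges. -/
structure Triangulation (n : ℕ) where
  src : Fin (2 * n + 3) → Fin (n + 3)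
  tgt : Fin (2 * n + 3) → Fin (n + 3)
  diag : ∀ i : Fin (2 * n + 3), i.val < n → IsDiag n (src i) (tgt i)
  bdry : ∀ i : Fin (2 * n + 3), n ≤ i.val → Adj n (src i) (tgt i)
  inj : ∀ i j : Fin (2 * n + 3), SamePair n (src i) (tgt i) (src j) (tgt j) → i = j
  noncross : ∀ i j : Fin (2 * n + 3), i ≠ j → ¬ Cross n (src i) (tgt i) (src j) (tgt j)
  bdry_complete : ∀ u v : Fin (n + 3), Adj n u v →
    ∃ i : Fin (2 * n + 3), n ≤ i.val ∧ SamePair n (src i) (tgt i) u v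
  maximal : ∀ u v : Fin (n + 3), IsDiag n u v →
    (∀ i : Fin (2 * n + 3), i.val < n → ¬ Cross n u v (src i) (tgt i)) →
    ∃ i : Fin (2 * n + 3), i.val < n ∧ SamePair n (src i) (tgt i) u v

/-- The edge `T_i` joins the vertices `u` and `v`. -/
def Joins (n : ℕ) (T : Triangulation n) (i : Fin (2 * n + 3)) (u v : Fin (n + 3)) : Prop :=
  SamePair n (T.src i) (T.tgt i) u v

/-- The edge `T_i` crosses the segment from `u` to `v`. -/
def ECross (n : ℕ) (T : Triangulation n) (i : Fin (2 * n + 3)) (u v : Fin (n + 3)) : Prop :=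
  Cross n (T.src i) (T.tgt i) u v

/-- The set of crossing points of the edge `T_i` with the segment from `u` to `v`. -/
def crossPts (n : ℕ) (T : Triangulation n) (i : Fin (2 * n + 3)) (u v : Fin (n + 3)) :
    Set (EuclideanSpace ℝ (Fin 2)) :=
  openSegment ℝ (vtx n (T.src i)) (vtx n (T.tgt i)) ∩ openSegment ℝ (vtx n u) (vtx n v)

/-- A default edge index. -/
def edef (n : ℕ) : Fin (2 * n + 3) := ⟨0, by omega⟩

/-- The data of a path: the list of vertices `a_0,…,a_ℓ` and the list of
edge indices `i_1,…,i_ℓ`. -/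
abbrev PathData (n : ℕ) := List (Fin (n + 3)) × List (Fin (2 * n + 3))

/-- `p` is a `T`-path from `a` to `b`: conditions (T1)–(T6). -/
def IsTPath (n : ℕ) (T : Triangulation n) (a b : Fin (n + 3)) (p : PathData n) : Prop :=
  -- the vertex list has one more entry than the edge list
  p.1.length = p.2.length + 1 ∧
  -- (T1)
  p.1.head? = some a ∧ p.1.getLast? = some b ∧
  -- (T2)
  (∀ k, k < p.2.length →
      Joins n T (p.2.getD k (edef n)) (p.1.getD k a) (p.1.getD (k + 1) a)) ∧
  -- (T3)
  p.2.Nodup ∧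
  -- (T4)
  Odd p.2.length ∧
  -- (T5) (list position `k` carries the `(k+1)`-st edge of the path)
  (∀ k, k < p.2.length → k % 2 = 1 → ECross n T (p.2.getD k (edef n)) a b) ∧
  -- (T6)
  (∀ j k, j < k → k < p.2.length →
      ∀ x ∈ crossPts n T (p.2.getD j (edef n)) a b,
      ∀ y ∈ crossPts n T (p.2.getD k (edef n)) a b,
        dist (vtx n a) x < dist (vtx n a) y)

/-- `𝒫_T(a,b)`: the set of `T`-paths from `a` to `b`. -/
def TPaths (n : ℕ) (T : Triangulation n) (a b : Fin (n + 3)) : Set (PathData n) :=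
  { p | IsTPath n T a b p }

/-- `𝒫_T(a,b)_j`: `T`-paths from `a` to `b` whose first edge is `T_j`. -/
def TPathsFirst (n : ℕ) (T : Triangulation n) (a b : Fin (n + 3)) (j : Fin (2 * n + 3)) :
    Set (PathData n) :=
  { p ∈ TPaths n T a b | p.2.head? = some j }

/-- `𝒫_T(a,b)_{-j}`: `T`-paths from `a` to `b` not containing the index `j`. -/
def TPathsAvoid (n : ℕ) (T : Triangulation n) (a b : Fin (n + 3)) (j : Fin (2 * n + 3)) :
    Set (PathData n) :=
  { p ∈ TPaths n T a b | j ∉ p.2 }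

/-- `𝒫_T(a,b)_{jk}`: `T`-paths from `a` to `b` whose first two edges are `T_j, T_k`. -/
def TPathsFirst2 (n : ℕ) (T : Triangulation n) (a b : Fin (n + 3))
    (j k : Fin (2 * n + 3)) : Set (PathData n) :=
  { p ∈ TPathsFirst n T a b j | p.2[1]? = some k }

/-- `𝒫_T(a,b)_{j,-k}`: `T`-paths from `a` to `b` whose first edge is `T_j` and which do
not contain the index `k`. -/
def TPathsFirstAvoid (n : ℕ) (T : Triangulation n) (a b : Fin (n + 3))
    (j k : Fin (2 * n + 3)) : Set (PathData n) :=
  { p ∈ TPathsFirst n T a b j | k ∉ p.2 }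

/-- The ambient field `F = ℚ(x_1,…,x_{2n+3})`. -/
abbrev F (n : ℕ) := FractionRing (MvPolynomial (Fin (2 * n + 3)) ℚ)

/-- The variable `x_i ∈ F` attached to the edge `T_i`. -/
def X (n : ℕ) (i : Fin (2 * n + 3)) : F n :=
  algebraMap (MvPolynomial (Fin (2 * n + 3)) ℚ) (F n) (MvPolynomial.X i)

/-- `x(α)` for a path with edge list `es = [i_1,…,i_ℓ]`: the product of the
variables of the odd edges times the inverse of the product of the variables of
the even edges (list position `k` carries the `(k+1)`-st edge). -/
def pathX (n : ℕ) (es : List (Fin (2 * n + 3))) : F n :=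
  (∏ k ∈ (Finset.range es.length).filter (fun k => k % 2 = 0), X n (es.getD k (edef n))) *
  (∏ k ∈ (Finset.range es.length).filter (fun k => k % 2 = 1), X n (es.getD k (edef n)))⁻¹

end

/-- Four vertices `p, q, r, s` occur in this cyclic order around the polygon. -/
def CyclicOrder4 (n : ℕ) (p q r s : Fin (n + 3)) : Prop :=
  (p.val < q.val ∧ q.val < r.val ∧ r.val < s.val) ∨
  (q.val < r.val ∧ r.val < s.val ∧ s.val < p.val) ∨
  (r.val < s.val ∧ s.val < p.val ∧ p.val < q.val) ∨
  (s.val < p.val ∧ p.val < q.val ∧ q.val < r.val)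

/-- `w` lies strictly between `u` and `v`. -/
def Inside (u v w : ℕ) : Prop := (u < w ∧ w < v) ∨ (v < w ∧ w < u)

/-- `w` lies strictly outside the interval spanned by `u` and `v`. -/
def Outside (u v w : ℕ) : Prop := (w < u ∧ w < v) ∨ (u < w ∧ v < w)

/-- The pairs `{u, v}` and `{w, z}` strictly separate each other on the circle. -/
def Interlace (u v w z : ℕ) : Prop :=
  (Inside u v w ∧ Outside u v z) ∨ (Outside u v w ∧ Inside u v z)

/-- Twice the signed area of the triangle `ABC`. -/
def area (A B C : EuclideanSpace ℝ (Fin 2)) : ℝ :=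
  (B 0 - A 0) * (C 1 - A 1) - (B 1 - A 1) * (C 0 - A 0)

theorem area_combo (A B C D : EuclideanSpace ℝ (Fin 2)) {s t : ℝ} (h : s + t = 1) :
    area A B (s • C + t • D) = s * area A B C + t * area A B D := by
  obtain rfl : t = 1 - s := by linarith
  simp only [area, PiLp.add_apply, PiLp.smul_apply, smul_eq_mul]
  ring

/-- Half the length of the oriented chord from the `u`-th to the `v`-th vertex. -/
noncomputable def hsin (n u v : ℕ) : ℝ := Real.sin (Real.pi * ((v : ℝ) - u) / (n + 3))

theorem hsin_pos {n u v : ℕ} (h : u < v) (hv : v < n + 3) : 0 < hsin n u v := by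
  have h1 : (u : ℝ) < v := by exact_mod_cast h
  have h2 : (v : ℝ) < n + 3 := by exact_mod_cast hv
  have h3 : (0 : ℝ) ≤ u := by positivity
  have h4 : (0 : ℝ) < n + 3 := by positivity
  apply Real.sin_pos_of_pos_of_lt_pi
  · have : 0 < (v : ℝ) - u := by linarith
    positivity
  · rw [div_lt_iff₀ h4]
    have := Real.pi_pos
    nlinarith

theorem hsin_swap (n u v : ℕ) : hsin n v u = - hsin n u v := by
  unfold hsin
  rw [← Real.sin_neg]
  congr 1
  ring

theorem hsin_neg {n u v : ℕ} (h : v < u) (hu : u < n + 3) : hsin n u v < 0 := by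
  rw [hsin_swap]
  linarith [hsin_pos h hu]

theorem area_vtx (n : ℕ) (u v w : Fin (n + 3)) :
    area (vtx n u) (vtx n v) (vtx n w) = 4 * (hsin n u v * (hsin n v w * hsin n u w)) := by
  have key : ∀ x y z : ℝ,
      (Real.cos (2 * y) - Real.cos (2 * x)) * (Real.sin (2 * z) - Real.sin (2 * x)) -
        (Real.sin (2 * y) - Real.sin (2 * x)) * (Real.cos (2 * z) - Real.cos (2 * x)) =
      4 * (Real.sin (y - x) * (Real.sin (z - y) * Real.sin (z - x))) := by
    intro x y z
    obtain ⟨p, rfl⟩ : ∃ p, y = x + p := ⟨y - x, by ring⟩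
    obtain ⟨q, rfl⟩ : ∃ q, z = x + p + q := ⟨z - (x + p), by ring⟩
    have e1 : (Real.cos (2 * (x + p)) - Real.cos (2 * x)) =
        -2 * Real.sin (2 * x + p) * Real.sin p := by
      rw [Real.cos_sub_cos]; ring_nf
    have e2 : (Real.sin (2 * (x + p)) - Real.sin (2 * x)) =
        2 * Real.sin p * Real.cos (2 * x + p) := by
      rw [Real.sin_sub_sin]; ring_nf
    have e3 : (Real.cos (2 * (x + p + q)) - Real.cos (2 * x)) =
        -2 * Real.sin (2 * x + p + q) * Real.sin (p + q) := by
      rw [Real.cos_sub_cos]; ring_nf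
    have e4 : (Real.sin (2 * (x + p + q)) - Real.sin (2 * x)) =
        2 * Real.sin (p + q) * Real.cos (2 * x + p + q) := by
      rw [Real.sin_sub_sin]; ring_nf
    rw [e1, e2, e3, e4, show x + p - x = p by ring, show x + p + q - (x + p) = q by ring,
      show x + p + q - x = p + q by ring]
    have : Real.sin q = Real.sin (2 * x + p + q) * Real.cos (2 * x + p) -
        Real.cos (2 * x + p + q) * Real.sin (2 * x + p) := by
      rw [← Real.sin_sub]; ring_nf
    rw [this]
    ring
  have := key (Real.pi * u / (n + 3)) (Real.pi * v / (n + 3)) (Real.pi * w / (n + 3))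
  simp only [area, vtx, hsin]
  simp only [WithLp.equiv_symm_apply, Matrix.cons_val_zero, Matrix.cons_val_one]
  convert this using 2 <;> ring_nf

theorem hsin_mul_neg {n u v w : ℕ} (hu : u < n + 3) (hv : v < n + 3) (hw : w < n + 3)
    (h : Inside u v w) : hsin n v w * hsin n u w < 0 := by
  rcases h with ⟨h1, h2⟩ | ⟨h1, h2⟩
  · exact mul_neg_of_neg_of_pos (hsin_neg h2 hv) (hsin_pos h1 hw)
  · exact mul_neg_of_pos_of_neg (hsin_pos h1 hw) (hsin_neg h2 hu)

theorem hsin_mul_pos {n u v w : ℕ} (hu : u < n + 3) (hv : v < n + 3) (hw : w < n + 3)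
    (h : Outside u v w) : 0 < hsin n v w * hsin n u w := by
  rcases h with ⟨h1, h2⟩ | ⟨h1, h2⟩
  · exact mul_pos_of_neg_of_neg (hsin_neg h2 hv) (hsin_neg h1 hu)
  · exact mul_pos (hsin_pos h2 hw) (hsin_pos h1 hw)

theorem hsin_sq_pos {n u v : ℕ} (hu : u < n + 3) (hv : v < n + 3) (h : u ≠ v) :
    0 < hsin n u v ^ 2 := by
  rcases lt_or_gt_of_ne h with h | h
  · exact pow_pos (hsin_pos h hv) 2
  · exact sq_pos_of_neg (hsin_neg h hu)

theorem area_mul_area (n : ℕ) (u v w z : Fin (n + 3)) :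
    area (vtx n u) (vtx n v) (vtx n w) * area (vtx n u) (vtx n v) (vtx n z) =
      16 * hsin n u v ^ 2 * ((hsin n v w * hsin n u w) * (hsin n v z * hsin n u z)) := by
  rw [area_vtx, area_vtx]
  ring

theorem area_mul_neg {n : ℕ} {u v w z : Fin (n + 3)} (h : Interlace u v w z) :
    area (vtx n u) (vtx n v) (vtx n w) * area (vtx n u) (vtx n v) (vtx n z) < 0 := by
  have huv : (u : ℕ) ≠ v := by
    unfold Interlace Inside Outside at h; omega
  have h0 := hsin_sq_pos u.2 v.2 huv
  rw [area_mul_area]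
  refine mul_neg_of_pos_of_neg (by positivity) ?_
  rcases h with ⟨h1, h2⟩ | ⟨h1, h2⟩
  · exact mul_neg_of_neg_of_pos (hsin_mul_neg u.2 v.2 w.2 h1) (hsin_mul_pos u.2 v.2 z.2 h2)
  · exact mul_neg_of_pos_of_neg (hsin_mul_pos u.2 v.2 w.2 h1) (hsin_mul_neg u.2 v.2 z.2 h2)

theorem area_mul_pos {n : ℕ} {u v w z : Fin (n + 3)} (huv : u ≠ v) (hwu : w ≠ u) (hwv : w ≠ v)
    (hzu : z ≠ u) (hzv : z ≠ v) (h : ¬ Interlace u v w z) :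
    0 < area (vtx n u) (vtx n v) (vtx n w) * area (vtx n u) (vtx n v) (vtx n z) := by
  have huv' : (u : ℕ) ≠ v := fun e => huv (Fin.ext e)
  have h0 := hsin_sq_pos u.2 v.2 huv'
  rw [area_mul_area]
  refine mul_pos (by positivity) ?_
  have : (Inside u v w ∧ Inside u v z) ∨ (Outside u v w ∧ Outside u v z) := by
    rw [Ne, Fin.ext_iff] at *
    unfold Interlace Inside Outside at *
    omega
  rcases this with ⟨h1, h2⟩ | ⟨h1, h2⟩
  · exact mul_pos_of_neg_of_neg (hsin_mul_neg u.2 v.2 w.2 h1) (hsin_mul_neg u.2 v.2 z.2 h2)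
  · exact mul_pos (hsin_mul_pos u.2 v.2 w.2 h1) (hsin_mul_pos u.2 v.2 z.2 h2)

theorem area_left (A B : EuclideanSpace ℝ (Fin 2)) : area A B A = 0 := by
  simp [area]

theorem area_right (A B : EuclideanSpace ℝ (Fin 2)) : area A B B = 0 := by
  simp [area]; ring

theorem Interlace.symm {u v w z : ℕ} (h : Interlace u v w z) : Interlace w z u v := by
  unfold Interlace Inside Outside at *
  omega

theorem cross_of_interlace {n : ℕ} {u v w z : Fin (n + 3)} (h : Interlace u v w z) :
    Cross n u v w z := by
  have h1 := area_mul_neg h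
  have h2 := area_mul_neg h.symm
  set U := vtx n u
  set V := vtx n v
  set W := vtx n w
  set Z := vtx n z
  have hS : area W Z V - area W Z U = area U V W - area U V Z := by
    simp only [area]; ring
  set A := area W Z V with hA
  set B := - area W Z U with hB
  set C := - area U V Z with hC
  set D := area U V W with hD
  have hAB : 0 < A * B := by linarith
  have hCD : 0 < C * D := by linarith
  have hne : A + B ≠ 0 := by
    intro h0
    have : A = - B := by linarith
    rw [this] at hAB
    nlinarith [sq_nonneg B]
  have hsum : A + B = C + D := by linarith
  have pos : ∀ x y : ℝ, 0 < x * y → 0 < x / (x + y) := by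
    intro x y hxy
    have hx : x ≠ 0 := by rintro rfl; simp at hxy
    rcases lt_or_gt_of_ne hx with hx | hx
    · have hy : y < 0 := by by_contra hy; nlinarith
      exact div_pos_of_neg_of_neg hx (by linarith)
    · have hy : 0 < y := by by_contra hy; nlinarith
      positivity
  refine ⟨(A / (A + B)) • U + (B / (A + B)) • V, ⟨_, _, pos A B hAB, ?_, ?_, rfl⟩,
    ⟨C / (C + D), D / (C + D), pos C D hCD, ?_, ?_, ?_⟩⟩
  · rw [add_comm A B]; exact pos B A (by linarith)
  · field_simp
  · rw [add_comm C D]; exact pos D C (by linarith)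
  · rw [← hsum] ; rw [← add_div, ← hsum]; field_simp
  · rw [← hsum]
    ext i
    simp only [PiLp.add_apply, PiLp.smul_apply, smul_eq_mul]
    field_simp
    simp only [hA, hB, hC, hD, area]
    fin_cases i <;> simp <;> ring

theorem interlace_of_cross {n : ℕ} {u v w z : Fin (n + 3)} (huv : u ≠ v) (hwz : w ≠ z)
    (h : Cross n u v w z) (hs : ¬ SamePair n u v w z) : Interlace u v w z := by
  by_contra hI
  obtain ⟨P, ⟨s, t, hs0, ht0, hst, rfl⟩, ⟨s', t', hs0', ht0', hst', hP⟩⟩ := h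
  have e1 : area (vtx n u) (vtx n v) (s • vtx n u + t • vtx n v) = 0 := by
    rw [area_combo _ _ _ _ hst, area_left, area_right]; ring
  rw [← hP, area_combo _ _ _ _ hst'] at e1
  have hne : ∀ x : Fin (n + 3), x ≠ u → x ≠ v → area (vtx n u) (vtx n v) (vtx n x) ≠ 0 := by
    intro x hxu hxv h0
    have := area_mul_pos (z := x) huv hxu hxv hxu hxv
      (by unfold Interlace Inside Outside; omega)
    simp [h0] at this
  by_cases hw : w = u ∨ w = v
  · have hz : z ≠ u ∧ z ≠ v := by
      unfold SamePair at hs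
      grind
    have := hne z hz.1 hz.2
    have h0 : area (vtx n u) (vtx n v) (vtx n w) = 0 := by
      rcases hw with rfl | rfl
      · exact area_left _ _
      · exact area_right _ _
    rw [h0] at e1
    exact mul_ne_zero ht0'.ne' this (by linarith)
  · push Not at hw
    by_cases hz : z = u ∨ z = v
    · have := mul_ne_zero hs0'.ne' (hne w hw.1 hw.2)
      have h0 : area (vtx n u) (vtx n v) (vtx n z) = 0 := by
        rcases hz with rfl | rfl
        · exact area_left _ _
        · exact area_right _ _
      rw [h0] at e1
      exact this (by linarith)
    · push Not at hz
      have hp := area_mul_pos huv hw.1 hw.2 hz.1 hz.2 hI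
      have hw0 := hne w hw.1 hw.2
      have : s' * area (vtx n u) (vtx n v) (vtx n w) ^ 2 + t' * (area (vtx n u) (vtx n v) (vtx n w) *
        area (vtx n u) (vtx n v) (vtx n z)) = 0 := by
        linear_combination area (vtx n u) (vtx n v) (vtx n w) * e1
      have h1 : 0 < s' * area (vtx n u) (vtx n v) (vtx n w) ^ 2 := by positivity
      have h2 := mul_pos ht0' hp
      linarith

/-- `w` lies on the chord `{x, y}` or on the side of it not containing `a`. -/
def Beyond (x y a w : ℕ) : Prop := w = x ∨ w = y ∨ Interlace x y a w

theorem dist_lt_of_beyond {n : ℕ} {a b x y x' y' : Fin (n + 3)} (hab : Interlace x y a b)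
    (hx' : Beyond x y a x') (hy' : Beyond x y a y') (hne : x' ≠ y') (hs : ¬ SamePair n x y x' y')
    {P Q : EuclideanSpace ℝ (Fin 2)}
    (hP : P ∈ openSegment ℝ (vtx n x) (vtx n y)) (hPab : P ∈ openSegment ℝ (vtx n a) (vtx n b))
    (hQ : Q ∈ openSegment ℝ (vtx n x') (vtx n y')) (hQab : Q ∈ openSegment ℝ (vtx n a) (vtx n b)) :
    dist (vtx n a) P < dist (vtx n a) Q := by
  set g : EuclideanSpace ℝ (Fin 2) → ℝ := fun Z =>
    area (vtx n x) (vtx n y) (vtx n a) * area (vtx n x) (vtx n y) Z with hg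
  have hcombo : ∀ {s t : ℝ} (C D), s + t = 1 → g (s • C + t • D) = s * g C + t * g D := by
    intro s t C D h
    simp only [hg, area_combo _ _ _ _ h]
    ring
  have hgb : g (vtx n b) < 0 := area_mul_neg hab
  have hga : 0 < g (vtx n a) := by
    have : area (vtx n x) (vtx n y) (vtx n a) ≠ 0 := by
      intro h0
      simp [hg, h0] at hgb
    exact mul_self_pos.mpr this
  have hB : ∀ w : Fin (n + 3), Beyond x y a w →
      g (vtx n w) ≤ 0 ∧ (w ≠ x → w ≠ y → g (vtx n w) < 0) := by
    rintro w (h | h | h)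
    · obtain rfl := Fin.ext h
      simp [hg, area_left]
    · obtain rfl := Fin.ext h
      simp [hg, area_right]
    · have : g (vtx n w) < 0 := area_mul_neg h
      exact ⟨this.le, fun _ _ => this⟩
  have hgP : g P = 0 := by
    obtain ⟨s, t, hs0, ht0, hst, rfl⟩ := hP
    rw [hcombo _ _ hst]
    simp [hg, area_left, area_right]
  have hgQ : g Q < 0 := by
    obtain ⟨s, t, hs0, ht0, hst, rfl⟩ := hQ
    rw [hcombo _ _ hst]
    obtain ⟨h1, h1'⟩ := hB _ hx'
    obtain ⟨h2, h2'⟩ := hB _ hy'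
    have : g (vtx n x') < 0 ∨ g (vtx n y') < 0 := by
      unfold SamePair at hs
      by_cases hx : x' = x ∨ x' = y
      · right
        apply h2' <;> grind
      · left
        apply h1' <;> grind
    rcases this with h | h <;> nlinarith
  have hd : ∀ {s t : ℝ}, 0 < t → s + t = 1 →
      dist (vtx n a) (s • vtx n a + t • vtx n b) = t * dist (vtx n a) (vtx n b) := by
    intro s t ht hst
    obtain rfl : s = 1 - t := by linarith
    rw [dist_eq_norm, dist_eq_norm,
      show vtx n a - ((1 - t) • vtx n a + t • vtx n b) = t • (vtx n a - vtx n b) by module,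
      norm_smul, Real.norm_of_nonneg ht.le]
  have hpos : 0 < dist (vtx n a) (vtx n b) := by
    rw [dist_pos]
    intro h
    rw [h] at hga
    linarith
  obtain ⟨s, t, hs0, ht0, hst, rfl⟩ := hPab
  obtain ⟨s', t', hs0', ht0', hst', rfl⟩ := hQab
  rw [hd ht0 hst, hd ht0' hst']
  rw [hcombo _ _ hst] at hgP
  rw [hcombo _ _ hst'] at hgQ
  refine mul_lt_mul_of_pos_right ?_ hpos
  nlinarith

section Edges

variable {n : ℕ} {T : Triangulation n}

theorem Joins.swap {i : Fin (2 * n + 3)} {u v : Fin (n + 3)} (h : Joins n T i u v) :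
    Joins n T i v u := by
  unfold Joins SamePair at *
  tauto

theorem Joins.ne {i : Fin (2 * n + 3)} {u v : Fin (n + 3)} (h : Joins n T i u v) : u ≠ v := by
  have : T.src i ≠ T.tgt i := by
    by_cases hi : i.val < n
    · exact (T.diag i hi).1
    · have := T.bdry i (by omega)
      unfold Adj at this
      intro h
      rw [h] at this
      have h1 := (T.tgt i).2
      rcases Nat.lt_or_ge ((T.tgt i).val + 1) (n + 3) with h2 | h2
      · rw [Nat.mod_eq_of_lt h2] at this; omega
      · rw [show (T.tgt i).val + 1 = n + 3 by omega, Nat.mod_self] at this; omega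
  unfold Joins SamePair at h
  grind

theorem Joins.index_unique {i j : Fin (2 * n + 3)} {u v : Fin (n + 3)} (h : Joins n T i u v)
    (h' : Joins n T j u v) : i = j := by
  apply T.inj
  unfold Joins SamePair at *
  grind

theorem Joins.eq_of_left {i : Fin (2 * n + 3)} {u v w : Fin (n + 3)} (h : Joins n T i u v)
    (h' : Joins n T i u w) : v = w := by
  have := h.ne
  have := h'.ne
  unfold Joins SamePair at *
  grind

theorem Interlace.swap_left {u v w z : ℕ} (h : Interlace u v w z) : Interlace v u w z := by
  unfold Interlace Inside Outside at *
  omega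

theorem Interlace.swap_right {u v w z : ℕ} (h : Interlace u v w z) : Interlace u v z w := by
  unfold Interlace Inside Outside at *
  omega

theorem interlace_swap_left_iff {u v w z : ℕ} : Interlace u v w z ↔ Interlace v u w z :=
  ⟨Interlace.swap_left, Interlace.swap_left⟩

theorem Joins.ends {i : Fin (2 * n + 3)} {u v : Fin (n + 3)} (h : Joins n T i u v) :
    (T.src i = u ∧ T.tgt i = v) ∨ (T.src i = v ∧ T.tgt i = u) := h

theorem Joins.not_interlace {i j : Fin (2 * n + 3)} {u v w z : Fin (n + 3)}
    (h : Joins n T i u v) (h' : Joins n T j w z) : ¬ Interlace u v w z := by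
  intro hI
  have hI' : Interlace (T.src i) (T.tgt i) (T.src j) (T.tgt j) := by
    rcases h.ends with ⟨e1, e2⟩ | ⟨e1, e2⟩ <;> rcases h'.ends with ⟨e3, e4⟩ | ⟨e3, e4⟩ <;>
      rw [e1, e2, e3, e4]
    · exact hI
    · exact hI.swap_right
    · exact hI.swap_left
    · exact hI.swap_left.swap_right
  have hij : i ≠ j := by
    rintro rfl
    unfold Interlace Inside Outside at hI'
    omega
  exact T.noncross i j hij (cross_of_interlace hI')

theorem exists_joins_of_adj {u v : Fin (n + 3)} (h : Adj n u v) : ∃ i, Joins n T i u v := by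
  obtain ⟨i, -, hi⟩ := T.bdry_complete u v h
  exact ⟨i, hi⟩

theorem exists_joins_of_not_interlace {u v : Fin (n + 3)} (huv : u ≠ v)
    (h : ∀ i w z, Joins n T i w z → ¬ Interlace w z u v) : ∃ i, Joins n T i u v := by
  by_cases hadj : Adj n u v
  · exact exists_joins_of_adj hadj
  · by_contra hno
    push Not at hno
    obtain ⟨i, -, hi⟩ := T.maximal u v ⟨huv, hadj⟩ (by
      intro i _ hc
      have hj : Joins n T i (T.src i) (T.tgt i) := Or.inl ⟨rfl, rfl⟩
      refine h i _ _ hj (interlace_of_cross huv hj.ne hc ?_).symm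
      intro hs
      apply hno i
      unfold Joins SamePair at *
      grind)
    exact hno i hi

theorem eCross_of_interlace {i : Fin (2 * n + 3)} {u v a b : Fin (n + 3)} (h : Joins n T i u v)
    (hI : Interlace u v a b) : ECross n T i a b := by
  apply cross_of_interlace
  rcases h.ends with ⟨e1, e2⟩ | ⟨e1, e2⟩ <;> rw [e1, e2]
  · exact hI
  · exact hI.swap_left

theorem ECross.interlace {i : Fin (2 * n + 3)} {u v a b : Fin (n + 3)} (hc : ECross n T i a b)
    (h : Joins n T i u v) (hab : a ≠ b) (hno : ∀ i, ¬ Joins n T i a b) : Interlace u v a b := by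
  have hj : Joins n T i (T.src i) (T.tgt i) := Or.inl ⟨rfl, rfl⟩
  have := interlace_of_cross hj.ne hab hc (hno i)
  rcases h.ends with ⟨e1, e2⟩ | ⟨e1, e2⟩ <;> rw [e1, e2] at this
  · exact this
  · exact this.swap_left

/-- Determinant of two plane vectors. -/
def det2 {K : Type*} [Field K] (x y : K × K) : K := x.1 * y.2 - x.2 * y.1

theorem exists_apex {e : Fin (2 * n + 3)} {i j : Fin (n + 3)} (h : Joins n T e i j)
    (hij : i.val + 1 < j.val) :
    ∃ k, i < k ∧ k < j ∧ (∃ f, Joins n T f i k) ∧ ∃ f, Joins n T f k j := by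
  have hs :
      (Set.toFinite {k : Fin (n + 3) | i < k ∧ k < j ∧ ∃ f, Joins n T f i k}).toFinset.Nonempty := by
    refine ⟨⟨i.val + 1, by omega⟩, ?_⟩
    simp only [Set.Finite.mem_toFinset, Set.mem_ofPred_eq, Fin.lt_def]
    refine ⟨by omega, by omega, exists_joins_of_adj (Or.inl ?_)⟩
    exact Nat.mod_eq_of_lt (by omega)
  obtain ⟨k, hk, hmax⟩ := Finset.exists_max_image _ (fun k : Fin (n + 3) => k) hs
  simp only [Set.Finite.mem_toFinset, Set.mem_ofPred_eq] at hk hmax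
  obtain ⟨hik, hkj, g, hg⟩ := hk
  refine ⟨k, hik, hkj, ⟨g, hg⟩, exists_joins_of_not_interlace hkj.ne ?_⟩
  have key : ∀ f w z, Joins n T f w z → k < w → w < j → ¬ Interlace w z k j := by
    intro f w z hw h1 h2 hI
    have n1 := hw.not_interlace h
    have n2 := hw.not_interlace hg
    have : z = i := by
      rw [Fin.ext_iff]
      rw [Fin.lt_def] at *
      unfold Interlace Inside Outside at *
      omega
    subst this
    exact absurd (hmax w ⟨hik.trans h1, h2, f, hw.swap⟩) (by omega)
  intro f w z hw hI
  by_cases h1 : k < w ∧ w < j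
  · exact key f w z hw h1.1 h1.2 hI
  · have h2 : k < z ∧ z < j := by
      rw [Fin.lt_def] at *
      unfold Interlace Inside Outside at hI
      omega
    exact key f z w hw.swap h2.1 h2.2 hI.swap_left

theorem X_ne_zero (i : Fin (2 * n + 3)) : X n i ≠ 0 := by
  unfold X
  rw [Ne, FaithfulSMul.algebraMap_eq_zero_iff]
  exact MvPolynomial.X_ne_zero i

theorem exists_vectors_on_interval (m : ℕ) : ∀ (i j : Fin (n + 3)), i < j → j.val - i.val ≤ m →
    ∀ e, Joins n T e i j → ∀ wi wj : F n × F n, det2 wi wj = X n e →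
    ∃ w : Fin (n + 3) → F n × F n, w i = wi ∧ w j = wj ∧
      ∀ f u v, i ≤ u → u < v → v ≤ j → Joins n T f u v → det2 (w u) (w v) = X n f := by
  induction m with
  | zero => intro i j hij h; rw [Fin.lt_def] at hij; omega
  | succ m ih =>
    intro i j hij hm e he wi wj hw
    rw [Fin.lt_def] at hij
    by_cases h1 : i.val + 1 = j.val
    · refine ⟨fun u => if u = i then wi else wj, by simp, if_neg (by rintro rfl; omega), ?_⟩
      intro f u v hu huv hv hf
      obtain rfl : u = i := by
        rw [Fin.ext_iff]; rw [Fin.lt_def] at *; rw [Fin.le_def] at *; omega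
      obtain rfl : v = j := by
        rw [Fin.ext_iff]; rw [Fin.lt_def] at *; rw [Fin.le_def] at *; omega
      obtain rfl := he.index_unique hf
      simp [huv.ne', hw]
    · obtain ⟨k, hik, hkj, ⟨f, hf⟩, ⟨g, hg⟩⟩ := exists_apex he (by omega)
      have he0 := X_ne_zero e
      set wk : F n × F n := ((X n g * wi.1 + X n f * wj.1) / X n e,
        (X n g * wi.2 + X n f * wj.2) / X n e) with hwk
      have hwik : det2 wi wk = X n f := by
        simp only [det2, hwk] at hw ⊢
        field_simp
        linear_combination X n f * hw
      have hwkj : det2 wk wj = X n g := by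
        simp only [det2, hwk] at hw ⊢
        field_simp
        linear_combination X n g * hw
      obtain ⟨w1, h1i, h1k, h1⟩ := ih i k hik (by rw [Fin.lt_def] at *; omega) f hf wi wk hwik
      obtain ⟨w2, h2k, h2j, h2⟩ := ih k j hkj (by rw [Fin.lt_def] at *; omega) g hg wk wj hwkj
      refine ⟨fun u => if u ≤ k then w1 u else w2 u, by simp [hik.le, h1i],
        by simp [not_le.mpr hkj, h2j], ?_⟩
      intro f' u v hu huv hv hf'
      dsimp only
      by_cases hvk : v ≤ k
      · rw [if_pos (huv.le.trans hvk), if_pos hvk]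
        exact h1 f' u v hu huv hvk hf'
      rw [if_neg hvk]
      by_cases huk : k ≤ u
      · have : (if u ≤ k then w1 u else w2 u) = w2 u := by
          split_ifs with h
          · rw [le_antisymm h huk, h1k, h2k]
          · rfl
        rw [this]
        exact h2 f' u v huk huv hv hf'
      · have n1 := hf'.not_interlace hf
        have n2 := hf'.not_interlace hg
        have : u = i ∧ v = j := by
          rw [Fin.ext_iff, Fin.ext_iff]
          rw [Fin.lt_def] at *
          rw [Fin.le_def] at *
          unfold Interlace Inside Outside at n1 n2
          omega
        obtain ⟨rfl, rfl⟩ := this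
        rw [if_pos hik.le, h1i, h2j, hw, he.index_unique hf']

theorem exists_vectors (T : Triangulation n) : ∃ w : Fin (n + 3) → F n × F n,
    ∀ f u v, u < v → Joins n T f u v → det2 (w u) (w v) = X n f := by
  obtain ⟨e, he⟩ : ∃ e, Joins n T e 0 (Fin.last (n + 2)) :=
    exists_joins_of_adj (Or.inr (by simp))
  obtain ⟨w, -, -, hw⟩ := exists_vectors_on_interval (n + 2) 0 (Fin.last (n + 2))
    (by simp [Fin.lt_def]) (by simp) e he (1, 0) (0, X n e) (by simp [det2])
  exact ⟨w, fun f u v huv hf => hw f u v (Fin.zero_le _) huv (Fin.le_last _) hf⟩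

/-- Determinant of the vectors at two vertices, taken in increasing order. -/
noncomputable def ordDet (w : Fin (n + 3) → F n × F n) (u v : Fin (n + 3)) : F n :=
  if u < v then det2 (w u) (w v) else det2 (w v) (w u)

theorem ordDet_ptolemy (w : Fin (n + 3) → F n × F n) {a b c d : Fin (n + 3)}
    (h : Interlace a b c d) :
    ordDet w a b * ordDet w c d =
      ordDet w a c * ordDet w d b + ordDet w a d * ordDet w c b := by
  unfold Interlace Inside Outside at h
  simp only [ordDet, Fin.lt_def]
  rcases h with ⟨h1 | h1, h2 | h2⟩ | ⟨h1 | h1, h2 | h2⟩ <;>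
    split_ifs <;> first | omega | (simp only [det2]; ring)

/-- The clockwise distance from `a` to `v` on a cycle of length `N`. -/
def cycDist (N a v : ℕ) : ℕ := if a ≤ v then v - a else v + N - a

theorem cycDist_cases (N o a : ℕ) (ho : o < N) :
    (o ≤ a ∧ cycDist N o a + o = a) ∨ (a < o ∧ cycDist N o a + o = a + N) := by
  unfold cycDist
  split_ifs <;> omega

set_option maxHeartbeats 1000000 in
theorem interlace_cycDist {N o a b c d : ℕ} (ho : o < N) (ha : a < N) (hb : b < N) (hc : c < N)
    (hd : d < N) :
    Interlace (cycDist N o a) (cycDist N o b) (cycDist N o c) (cycDist N o d) ↔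
      Interlace a b c d := by
  have h1 := cycDist_cases N o a ho
  have h2 := cycDist_cases N o b ho
  have h3 := cycDist_cases N o c ho
  have h4 := cycDist_cases N o d ho
  generalize cycDist N o a = a' at *
  generalize cycDist N o b = b' at *
  generalize cycDist N o c = c' at *
  generalize cycDist N o d = d' at *
  unfold Interlace Inside Outside
  rcases h1 with ⟨h1, h1'⟩ | ⟨h1, h1'⟩ <;> rcases h2 with ⟨h2, h2'⟩ | ⟨h2, h2'⟩ <;>
  rcases h3 with ⟨h3, h3'⟩ | ⟨h3, h3'⟩ <;> rcases h4 with ⟨h4, h4'⟩ | ⟨h4, h4'⟩ <;>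
  grind

theorem exists_first_triangle {a b : Fin (n + 3)} (hab : a ≠ b) (hno : ∀ i, ¬ Joins n T i a b) :
    ∃ c d : Fin (n + 3), Interlace a b c d ∧ (∃ i, Joins n T i a c) ∧ (∃ i, Joins n T i a d) ∧
      ∃ i, Joins n T i c d := by
  set ρ : Fin (n + 3) → ℕ := fun v => cycDist (n + 3) a v with hρ
  have hI : ∀ u v w z : Fin (n + 3), Interlace (ρ u) (ρ v) (ρ w) (ρ z) ↔ Interlace u v w z :=
    fun u v w z => interlace_cycDist a.2 u.2 v.2 w.2 z.2
  have hinj : ∀ u v : Fin (n + 3), ρ u = ρ v → u = v := by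
    intro u v h
    simp only [hρ, cycDist] at h
    rw [Fin.ext_iff]
    split_ifs at h <;> omega
  have ha : ρ a = 0 := by simp [hρ, cycDist]
  have hlt : ∀ v, ρ v < n + 3 := by
    intro v
    simp only [hρ, cycDist]
    split_ifs <;> omega
  obtain ⟨s, hs⟩ : ∃ s : Fin (n + 3), Adj n a s ∧ ρ s = 1 := by
    refine ⟨⟨(a.val + 1) % (n + 3), Nat.mod_lt _ (by omega)⟩, Or.inl rfl, ?_⟩
    simp only [hρ, cycDist]
    rcases Nat.lt_or_ge (a.val + 1) (n + 3) with h | h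
    · rw [Nat.mod_eq_of_lt h]; split_ifs <;> omega
    · rw [show a.val + 1 = n + 3 by omega, Nat.mod_self]; split_ifs <;> omega
  obtain ⟨t, ht⟩ : ∃ t : Fin (n + 3), Adj n a t ∧ ρ t = n + 2 := by
    refine ⟨⟨(a.val + (n + 2)) % (n + 3), Nat.mod_lt _ (by omega)⟩, Or.inr ?_, ?_⟩
    · rw [Nat.mod_add_mod, show a.val + (n + 2) + 1 = a.val + (n + 3) by omega, Nat.add_mod_right,
        Nat.mod_eq_of_lt a.2]
    · simp only [hρ, cycDist]
      rcases Nat.eq_zero_or_pos a.val with h | h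
      · rw [h, Nat.mod_eq_of_lt (by omega)]; split_ifs <;> omega
      · rw [show a.val + (n + 2) = (a.val - 1) + (n + 3) by omega, Nat.add_mod_right,
          Nat.mod_eq_of_lt (by omega)]; split_ifs <;> omega
  have hb0 : ρ b ≠ 0 := fun h => hab (hinj _ _ (ha.trans h.symm))
  have hb1 : ρ b ≠ 1 := by
    intro h
    obtain rfl := hinj _ _ (h.trans hs.2.symm)
    obtain ⟨i, hi⟩ := exists_joins_of_adj (T := T) hs.1
    exact hno i hi
  have hb2 : ρ b ≠ n + 2 := by
    intro h
    obtain rfl := hinj _ _ (h.trans ht.2.symm)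
    obtain ⟨i, hi⟩ := exists_joins_of_adj (T := T) ht.1
    exact hno i hi
  have hbl := hlt b
  obtain ⟨d, hd, hdmax⟩ := Finset.exists_max_image
    (Finset.univ.filter fun v => ρ v < ρ b ∧ ∃ i, Joins n T i a v) ρ
    ⟨s, by simp only [Finset.mem_filter, Finset.mem_univ, true_and]
           exact ⟨by omega, exists_joins_of_adj hs.1⟩⟩
  obtain ⟨c, hc, hcmin⟩ := Finset.exists_min_image
    (Finset.univ.filter fun v => ρ b < ρ v ∧ ∃ i, Joins n T i a v) ρ
    ⟨t, by simp only [Finset.mem_filter, Finset.mem_univ, true_and]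
           exact ⟨by omega, exists_joins_of_adj ht.1⟩⟩
  simp only [Finset.mem_filter, Finset.mem_univ, true_and] at hd hc hdmax hcmin
  obtain ⟨hdb, i, hi⟩ := hd
  obtain ⟨hcb, j, hj⟩ := hc
  have hd0 : ρ d ≠ 0 := fun h => hi.ne (hinj _ _ (ha.trans h.symm))
  refine ⟨c, d, ?_, ⟨j, hj⟩, ⟨i, hi⟩, exists_joins_of_not_interlace ?_ ?_⟩
  · rw [← hI, ha]
    unfold Interlace Inside Outside
    omega
  · rintro rfl
    omega
  have key : ∀ f w z, Joins n T f w z → ρ d < ρ w → ρ w < ρ c → ¬ Interlace w z c d := by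
    intro f w z hf h1 h2 h
    have n1 := hf.not_interlace hi
    have n2 := hf.not_interlace hj
    rw [← hI] at h n1 n2
    rw [ha] at n1 n2
    have : z = a := by
      apply hinj
      rw [ha]
      unfold Interlace Inside Outside at *
      omega
    subst this
    rcases lt_trichotomy (ρ w) (ρ b) with h3 | h3 | h3
    · have := hdmax w ⟨h3, f, hf.swap⟩
      omega
    · obtain rfl := hinj _ _ h3
      exact hno f hf.swap
    · have := hcmin w ⟨h3, f, hf.swap⟩
      omega
  intro f w z hf h
  by_cases h1 : ρ d < ρ w ∧ ρ w < ρ c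
  · exact key f w z hf h1.1 h1.2 h
  · have h2 : ρ d < ρ z ∧ ρ z < ρ c := by
      rw [← hI] at h
      unfold Interlace Inside Outside at h
      omega
    exact key f z w hf.swap h2.1 h2.2 h.swap_left

end Edges

section Paths

variable {n : ℕ}

/-- The list `vs` of later vertices and the list `es` of edges describe a walk in `T` from `v` to
`b` whose last edge is odd-numbered and whose even-numbered edges satisfy `P`; the flag `t` tells
whether the next edge is odd-numbered. -/
def IsWalk (T : Triangulation n) (P : Fin (2 * n + 3) → Prop) (b : Fin (n + 3)) :
    Bool → Fin (n + 3) → List (Fin (n + 3)) → List (Fin (2 * n + 3)) → Prop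
  | t, v, [], [] => t = false ∧ v = b
  | t, v, w :: vs, e :: es => (t = false → P e) ∧ Joins n T e v w ∧ IsWalk T P b (!t) w vs es
  | _, _, [], _ :: _ => False
  | _, _, _ :: _, [] => False

/-- The pairwise condition on the edges of a `T`-path from `a` to `b`. -/
def Ordered (T : Triangulation n) (a b : Fin (n + 3)) (e f : Fin (2 * n + 3)) : Prop :=
  e ≠ f ∧ ∀ x ∈ crossPts n T e a b, ∀ y ∈ crossPts n T f a b,
    dist (vtx n a) x < dist (vtx n a) y

theorem isWalk_iff (T : Triangulation n) (P : Fin (2 * n + 3) → Prop) (b d : Fin (n + 3)) :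
    ∀ (es : List (Fin (2 * n + 3))) (t : Bool) (v : Fin (n + 3)) (vs : List (Fin (n + 3))),
    IsWalk T P b t v vs es ↔ vs.length = es.length ∧ (v :: vs).getLast? = some b ∧
      (∀ k, k < es.length → Joins n T (es.getD k (edef n)) ((v :: vs).getD k d)
        ((v :: vs).getD (k + 1) d)) ∧
      es.length % 2 = (if t then 1 else 0) ∧
      (∀ k, k < es.length → k % 2 = (if t then 1 else 0) → P (es.getD k (edef n)))
  | [], t, v, [] => by cases t <;> simp [IsWalk]
  | [], t, v, w :: vs => by simp [IsWalk]
  | e :: es, t, v, [] => by simp [IsWalk]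
  | e :: es, t, v, w :: vs => by
    rw [IsWalk, isWalk_iff T P b d es]
    simp only [List.length_cons, Nat.forall_lt_succ_left, List.getLast?_cons_cons,
      List.getD_cons_zero, List.getD_cons_succ, Nat.add_right_cancel_iff]
    cases t
    · simp only [Bool.not_false, if_true, Bool.false_eq_true, if_false, Nat.zero_mod,
        forall_const]
      have h1 : ∀ m : ℕ, (m + 1) % 2 = 0 ↔ m % 2 = 1 := by intro m; omega
      simp only [h1]
      tauto
    · simp only [Bool.not_true, if_true, Bool.false_eq_true, if_false, Nat.zero_mod,
        Bool.true_eq_false, false_imp_iff, true_and, zero_ne_one]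
      have h1 : ∀ m : ℕ, (m + 1) % 2 = 1 ↔ m % 2 = 0 := by intro m; omega
      simp only [h1]
      tauto

theorem mem_TPaths_iff (T : Triangulation n) (a b : Fin (n + 3)) (p : PathData n) :
    p ∈ TPaths n T a b ↔ ∃ vs, p.1 = a :: vs ∧
      IsWalk T (fun e => ECross n T e a b) b true a vs p.2 ∧ p.2.Pairwise (Ordered T a b) := by
  obtain ⟨us, es⟩ := p
  have hpw : es.Pairwise (Ordered T a b) ↔ es.Nodup ∧ (∀ j k, j < k → k < es.length →
      ∀ x ∈ crossPts n T (es.getD j (edef n)) a b,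
      ∀ y ∈ crossPts n T (es.getD k (edef n)) a b,
        dist (vtx n a) x < dist (vtx n a) y) := by
    unfold Ordered
    rw [List.pairwise_and_iff, List.Nodup]
    refine and_congr_right fun _ => ?_
    rw [List.pairwise_iff_getElem]
    constructor
    · intro h j k hjk hk
      rw [List.getD_eq_getElem _ _ hk, List.getD_eq_getElem _ _ (hjk.trans hk)]
      exact h j k (hjk.trans hk) hk hjk
    · intro h j k hj hk hjk
      have := h j k hjk hk
      rwa [List.getD_eq_getElem _ _ hk, List.getD_eq_getElem _ _ hj] at this
  rw [hpw]
  simp only [TPaths, Set.mem_ofPred_eq, IsTPath]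
  constructor
  · rintro ⟨h1, h2, h3, h4, h5, h6, h7, h8⟩
    cases us with
    | nil => simp at h1
    | cons v vs =>
      obtain rfl : v = a := by simpa using h2
      refine ⟨vs, rfl, ?_, h5, h8⟩
      rw [isWalk_iff T _ b v]
      exact ⟨by simpa using h1, h3, h4, by simpa [Nat.odd_iff] using h6, by simpa using h7⟩
  · rintro ⟨vs, rfl, h, h5, h8⟩
    rw [isWalk_iff T _ b a] at h
    obtain ⟨h1, h3, h4, h6, h7⟩ := h
    exact ⟨by simpa using h1, rfl, h3, h4, h5, by simpa [Nat.odd_iff] using h6,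
      by simpa using h7, h8⟩

theorem prod_filter_range_succ {M : Type*} [CommMonoid M] (f : ℕ → M) (p : ℕ → Prop)
    [DecidablePred p] (m : ℕ) :
    ∏ k ∈ (Finset.range (m + 1)).filter p, f k =
      (if p 0 then f 0 else 1) * ∏ k ∈ (Finset.range m).filter (fun k => p (k + 1)), f (k + 1) := by
  rw [Finset.prod_filter, Finset.prod_filter, Finset.prod_range_succ', mul_comm]

theorem pathX_cons (e : Fin (2 * n + 3)) (es : List (Fin (2 * n + 3))) :
    pathX n (e :: es) = X n e * (pathX n es)⁻¹ := by
  have h1 : ∀ m : ℕ, (m + 1) % 2 = 0 ↔ m % 2 = 1 := by intro m; omega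
  have h2 : ∀ m : ℕ, (m + 1) % 2 = 1 ↔ m % 2 = 0 := by intro m; omega
  simp only [pathX, List.length_cons]
  rw [prod_filter_range_succ, prod_filter_range_succ]
  simp only [h1, h2, List.getD_cons_zero, List.getD_cons_succ, mul_inv, inv_inv]
  simp
  ring

theorem finite_TPaths (T : Triangulation n) (a b : Fin (n + 3)) : (TPaths n T a b).Finite := by
  refine ((List.finite_length_le (Fin (n + 3)) (2 * n + 4)).prod
    (List.finite_length_le (Fin (2 * n + 3)) (2 * n + 3))).subset ?_
  rintro ⟨us, es⟩ ⟨h1, -, -, -, h5, -⟩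
  have := h5.length_le_card
  rw [Fintype.card_fin] at this
  simp only at h1 this
  simp only [Set.mem_prod, Set.mem_ofPred_eq]
  omega

end Paths

theorem beyond_swap_left_iff {x y a w : ℕ} : Beyond x y a w ↔ Beyond y x a w := by
  unfold Beyond
  rw [interlace_swap_left_iff]
  tauto

set_option maxHeartbeats 1000000 in
theorem beyond_total {a b x y x' y' : ℕ} (h : Interlace x y a b) (h' : Interlace x' y' a b)
    (hn : ¬ Interlace x y x' y') :
    (Beyond x y a x' ∧ Beyond x y a y') ∨ (Beyond x' y' a x ∧ Beyond x' y' a y) := by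
  wlog hxy : x < y generalizing x y
  · have hne : x ≠ y := by rintro rfl; unfold Interlace Inside Outside at h; omega
    have := this h.swap_left (fun q => hn q.swap_left) (by omega)
    rw [beyond_swap_left_iff, beyond_swap_left_iff (w := y')] at this
    tauto
  wlog hxy' : x' < y' generalizing x' y'
  · have hne : x' ≠ y' := by rintro rfl; unfold Interlace Inside Outside at h'; omega
    have := this h'.swap_left (fun q => hn q.swap_right) (by omega)
    rw [beyond_swap_left_iff (x := y'), beyond_swap_left_iff (x := y')] at this
    tauto
  unfold Beyond Interlace Inside Outside at *
  grind (splits := 40)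

set_option maxHeartbeats 1000000 in
theorem interlace_of_interlace_right {a b c d x y : ℕ} (h : Interlace a b c d)
    (hx : Interlace x y d b) (h1 : ¬ Interlace x y a d) (h2 : ¬ Interlace x y c d) :
    Interlace x y a b ∧ x ≠ a ∧ y ≠ a ∧ x ≠ d ∧ y ≠ d := by
  unfold Interlace Inside Outside at *
  grind (splits := 40)

theorem interlace_replace {a b d x y : ℕ} (hx : Interlace x y a b) (h1 : ¬ Interlace x y a d)
    (hd : x ≠ d) (hd' : y ≠ d) : Interlace x y d b := by
  unfold Interlace Inside Outside at *
  grind (splits := 40)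

theorem beyond_congr {a d x y : ℕ} (h1 : ¬ Interlace x y a d)
    (hxa : x ≠ a) (hya : y ≠ a) (hxd : x ≠ d) (hyd : y ≠ d) (w : ℕ) :
    Beyond x y a w ↔ Beyond x y d w := by
  unfold Beyond Interlace Inside Outside at *
  grind (splits := 40)

set_option maxHeartbeats 1000000 in
theorem eq_or_eq_of_first_triangle {a b c d v w : ℕ} (h : Interlace a b c d)
    (hv : Interlace v w a b) (h1 : ¬ Interlace v w a c) (h2 : ¬ Interlace v w a d)
    (h4 : ¬ Interlace a v c d) : v = c ∨ v = d := by
  unfold Interlace Inside Outside at *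
  grind (splits := 40)

theorem Interlace.ne {u v w z : ℕ} (h : Interlace u v w z) :
    u ≠ v ∧ w ≠ z ∧ u ≠ w ∧ u ≠ z ∧ v ≠ w ∧ v ≠ z := by
  unfold Interlace Inside Outside at *
  omega

section Crossings

variable {n : ℕ}

/-- The edge `T_f` strictly crosses the chord from `a` to `b`. -/
def Crosses (T : Triangulation n) (a b : Fin (n + 3)) (f : Fin (2 * n + 3)) : Prop :=
  Interlace (T.src f) (T.tgt f) a b

/-- The edge `T_f` lies weakly beyond the edge `T_e` as seen from `a`. -/
def Precedes (T : Triangulation n) (a : Fin (n + 3)) (e f : Fin (2 * n + 3)) : Prop :=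
  Beyond (T.src e) (T.tgt e) a (T.src f) ∧ Beyond (T.src e) (T.tgt e) a (T.tgt f)

/-- Combinatorial form of `Ordered`. -/
def SeqRel (T : Triangulation n) (a b : Fin (n + 3)) (e f : Fin (2 * n + 3)) : Prop :=
  e ≠ f ∧ (Crosses T a b e → Crosses T a b f → Precedes T a e f)

/-- The vertex `v` is an endpoint of the edge `T_f`. -/
def Inc (T : Triangulation n) (f : Fin (2 * n + 3)) (v : Fin (n + 3)) : Prop :=
  T.src f = v ∨ T.tgt f = v

variable {T : Triangulation n}

theorem joins_ends (f : Fin (2 * n + 3)) : Joins n T f (T.src f) (T.tgt f) := Or.inl ⟨rfl, rfl⟩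

theorem Joins.crosses_iff {f : Fin (2 * n + 3)} {u v a b : Fin (n + 3)} (h : Joins n T f u v) :
    Crosses T a b f ↔ Interlace u v a b := by
  unfold Crosses
  rcases h.ends with ⟨e1, e2⟩ | ⟨e1, e2⟩ <;> rw [e1, e2]
  exact interlace_swap_left_iff

theorem Joins.inc_iff {f : Fin (2 * n + 3)} {u v z : Fin (n + 3)} (h : Joins n T f u v) :
    Inc T f z ↔ z = u ∨ z = v := by
  unfold Inc
  rcases h.ends with ⟨e1, e2⟩ | ⟨e1, e2⟩ <;> rw [e1, e2] <;> grind

theorem Joins.inc_left {f : Fin (2 * n + 3)} {u v : Fin (n + 3)} (h : Joins n T f u v) :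
    Inc T f u := h.inc_iff.mpr (Or.inl rfl)

theorem Joins.inc_right {f : Fin (2 * n + 3)} {u v : Fin (n + 3)} (h : Joins n T f u v) :
    Inc T f v := h.inc_iff.mpr (Or.inr rfl)

theorem joins_of_inc {f : Fin (2 * n + 3)} {u v : Fin (n + 3)} (huv : u ≠ v) (hu : Inc T f u)
    (hv : Inc T f v) : Joins n T f u v := by
  unfold Inc Joins SamePair at *
  grind

theorem precedes_total {a b : Fin (n + 3)} {e f : Fin (2 * n + 3)} (he : Crosses T a b e)
    (hf : Crosses T a b f) : Precedes T a e f ∨ Precedes T a f e :=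
  beyond_total he hf ((joins_ends e).not_interlace (joins_ends f))

theorem Precedes.dist_lt {a b : Fin (n + 3)} {e f : Fin (2 * n + 3)} (he : Crosses T a b e)
    (h : Precedes T a e f) (hef : e ≠ f) {x y : EuclideanSpace ℝ (Fin 2)}
    (hx : x ∈ crossPts n T e a b) (hy : y ∈ crossPts n T f a b) :
    dist (vtx n a) x < dist (vtx n a) y :=
  dist_lt_of_beyond he h.1 h.2 (joins_ends f).ne (fun hs => hef (T.inj _ _ hs)) hx.1 hx.2 hy.1 hy.2

theorem eCross_iff_crosses {a b : Fin (n + 3)} (hab : a ≠ b) (hno : ∀ i, ¬ Joins n T i a b)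
    (f : Fin (2 * n + 3)) : ECross n T f a b ↔ Crosses T a b f :=
  ⟨fun h => h.interlace (joins_ends f) hab hno, fun h => eCross_of_interlace (joins_ends f) h⟩

theorem ordered_iff_seqRel {a b : Fin (n + 3)} (hab : a ≠ b) (hno : ∀ i, ¬ Joins n T i a b)
    (e f : Fin (2 * n + 3)) : Ordered T a b e f ↔ SeqRel T a b e f := by
  unfold Ordered SeqRel
  refine and_congr_right fun hef => ⟨fun h he hf => ?_, fun h x hx y hy => ?_⟩
  · refine (precedes_total he hf).resolve_right fun hp => ?_
    obtain ⟨x, hx⟩ := (eCross_iff_crosses hab hno e).mpr he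
    obtain ⟨y, hy⟩ := (eCross_iff_crosses hab hno f).mpr hf
    exact (h x hx y hy).asymm (hp.dist_lt hf hef.symm hy hx)
  · have he := (eCross_iff_crosses hab hno e).mp ⟨x, hx⟩
    have hf := (eCross_iff_crosses hab hno f).mp ⟨y, hy⟩
    exact (h he hf).dist_lt he hef hx hy

theorem eq_of_eCross_edge {a b : Fin (n + 3)} {m f : Fin (2 * n + 3)} (hm : Joins n T m a b)
    (hf : ECross n T f a b) : f = m := by
  by_contra hne
  apply T.noncross f m hne
  rcases hm.ends with ⟨e1, e2⟩ | ⟨e1, e2⟩ <;> rw [e1, e2]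
  · exact hf
  · unfold Cross
    rw [openSegment_symm ℝ (vtx n b)]
    exact hf

theorem mem_TPaths_edge_iff {a b : Fin (n + 3)} {m : Fin (2 * n + 3)} (hm : Joins n T m a b)
    {P : Fin (2 * n + 3) → Prop} {R : Fin (2 * n + 3) → Fin (2 * n + 3) → Prop}
    (hP : ∀ f, P f → f = m) (hR : ∀ e f, R e f → e ≠ f) {vs : List (Fin (n + 3))}
    {es : List (Fin (2 * n + 3))} :
    (IsWalk T P b true a vs es ∧ es.Pairwise R) ↔ vs = [b] ∧ es = [m] := by
  constructor
  · rintro ⟨hw, hp⟩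
    match vs, es, hw with
    | [], [], hw => simp [IsWalk] at hw
    | [v], [e], hw =>
      simp only [IsWalk] at hw
      obtain ⟨-, hj, -, rfl⟩ := hw
      simp [hj.index_unique hm]
    | v :: w :: vs, e :: f :: es, hw =>
      exfalso
      simp only [IsWalk] at hw
      obtain ⟨-, hj, hf, hj', -⟩ := hw
      obtain rfl := hP f (hf rfl)
      have hef : e ≠ f := hR _ _ (List.rel_of_pairwise_cons hp (by simp))
      have hva := hj.ne
      have := hm.inc_iff.mp hj'.inc_left
      obtain rfl : v = b := by tauto
      exact hef (hj.index_unique hm)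
  · rintro ⟨rfl, rfl⟩
    simp [IsWalk, hm]

theorem mem_TPaths_iff_seqRel {a b : Fin (n + 3)} (hab : a ≠ b) (p : PathData n) :
    p ∈ TPaths n T a b ↔ ∃ vs, p.1 = a :: vs ∧
      IsWalk T (Crosses T a b) b true a vs p.2 ∧ p.2.Pairwise (SeqRel T a b) := by
  rw [mem_TPaths_iff]
  by_cases hno : ∀ i, ¬ Joins n T i a b
  · have h1 : (fun e => ECross n T e a b) = Crosses T a b :=
      funext fun f => propext (eCross_iff_crosses hab hno f)
    have h2 : Ordered T a b = SeqRel T a b :=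
      funext fun e => funext fun f => propext (ordered_iff_seqRel hab hno e f)
    rw [h1, h2]
  · push Not at hno
    obtain ⟨m, hm⟩ := hno
    refine exists_congr fun vs => and_congr_right fun _ => ?_
    rw [mem_TPaths_edge_iff hm (fun f hf => eq_of_eCross_edge hm hf) (fun e f h => h.1),
      mem_TPaths_edge_iff hm (fun f hf => ?_) (fun e f h => h.1)]
    exact absurd hf ((joins_ends f).not_interlace hm)

theorem TPaths_edge {a b : Fin (n + 3)} {m : Fin (2 * n + 3)} (hm : Joins n T m a b) :
    TPaths n T a b = {([a, b], [m])} := by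
  ext ⟨us, es⟩
  rw [mem_TPaths_iff, Set.mem_singleton_iff, Prod.mk.injEq]
  simp only [mem_TPaths_edge_iff (P := fun e => ECross n T e a b) hm
    (fun f hf => eq_of_eCross_edge hm hf) (fun e f (h : Ordered T a b e f) => h.1)]
  constructor
  · rintro ⟨vs, rfl, rfl, rfl⟩
    simp
  · rintro ⟨rfl, rfl⟩
    exact ⟨_, rfl, rfl, rfl⟩

theorem IsWalk.imp {P Q : Fin (2 * n + 3) → Prop} {b : Fin (n + 3)} :
    ∀ {es : List (Fin (2 * n + 3))} {vs : List (Fin (n + 3))} {t : Bool} {v : Fin (n + 3)},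
    IsWalk T P b t v vs es → (∀ f ∈ es, P f → Q f) → IsWalk T Q b t v vs es
  | [], [], _, _, h, _ => h
  | [], _ :: _, _, _, h, _ => h
  | _ :: _, [], _, _, h, _ => h
  | e :: _, _ :: _, _, _, ⟨h1, h2, h3⟩, hPQ =>
    ⟨fun ht => hPQ e (by simp) (h1 ht), h2, h3.imp fun f hf => hPQ f (by simp [hf])⟩

theorem IsWalk.start_ne {P : Fin (2 * n + 3) → Prop} {b z v : Fin (n + 3)}
    {es : List (Fin (2 * n + 3))} {vs : List (Fin (n + 3))} (h : IsWalk T P b false v vs es)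
    (hP : ∀ f, P f → ¬ Inc T f z) (hb : b ≠ z) : v ≠ z := by
  match vs, es, h with
  | [], [], h => exact h.2.trans_ne hb
  | w :: vs, e :: es, ⟨h1, h2, _⟩ =>
    rintro rfl
    exact hP e (h1 rfl) h2.inc_left

theorem IsWalk.not_inc {P : Fin (2 * n + 3) → Prop} {b z : Fin (n + 3)}
    (hP : ∀ f, P f → ¬ Inc T f z) (hb : b ≠ z) :
    ∀ {es : List (Fin (2 * n + 3))} {vs : List (Fin (n + 3))} {t : Bool} {v : Fin (n + 3)},
    IsWalk T P b t v vs es → (t = true → v ≠ z) → ∀ e ∈ es, ¬ Inc T e z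
  | [], _, _, _, _, _ => by simp
  | _ :: _, [], _, _, h, _ => h.elim
  | e :: es, w :: vs, false, v, ⟨h1, h2, h3⟩, _ => by
    have he := hP e (h1 rfl)
    rw [List.forall_mem_cons]
    exact ⟨he, h3.not_inc hP hb fun _ hw => he (hw ▸ h2.inc_right)⟩
  | e :: es, w :: vs, true, v, ⟨h1, h2, h3⟩, hv => by
    have hw : w ≠ z := IsWalk.start_ne h3 hP hb
    have hv := hv rfl
    rw [List.forall_mem_cons]
    refine ⟨?_, h3.not_inc hP hb (by simp)⟩
    rw [h2.inc_iff]
    tauto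

end Crossings

section Expansion

variable {n : ℕ} {T : Triangulation n}

/-- `a, c, d` are the vertices of a triangle of `T` with sides `T_i = ac`, `T_j = ad`, `T_k = cd`,
and the segment from `a` to `b` leaves it through `cd`. -/
structure FirstTriangle (T : Triangulation n) (a b c d : Fin (n + 3)) (i j k : Fin (2 * n + 3)) :
    Prop where
  interlace : Interlace a b c d
  left : Joins n T i a c
  right : Joins n T j a d
  base : Joins n T k c d

namespace FirstTriangle

variable {a b c d : Fin (n + 3)} {i j k : Fin (2 * n + 3)}

theorem swap (H : FirstTriangle T a b c d i j k) : FirstTriangle T a b d c j i k :=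
  ⟨H.interlace.swap_right, H.right, H.left, H.base.swap⟩

theorem ne_ab (H : FirstTriangle T a b c d i j k) : a ≠ b := fun h => H.interlace.ne.1 (by rw [h])

theorem ne_ad (H : FirstTriangle T a b c d i j k) : a ≠ d := H.right.ne

theorem ne_bd (H : FirstTriangle T a b c d i j k) :
    b ≠ d := fun h => H.interlace.ne.2.2.2.2.2 (by rw [h])

theorem ne_bc (H : FirstTriangle T a b c d i j k) : b ≠ c := H.swap.ne_bd

theorem not_joins (H : FirstTriangle T a b c d i j k)
    (f : Fin (2 * n + 3)) : ¬ Joins n T f a b := fun h =>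
  h.not_interlace H.base H.interlace

theorem crosses_of_crosses (H : FirstTriangle T a b c d i j k)
    {f : Fin (2 * n + 3)} (hf : Crosses T d b f) :
    Crosses T a b f ∧ ¬ Inc T f a ∧ ¬ Inc T f d := by
  have h := interlace_of_interlace_right H.interlace hf ((joins_ends f).not_interlace H.right)
    ((joins_ends f).not_interlace H.base)
  refine ⟨h.1, ?_, ?_⟩ <;> simp only [Inc, Fin.ext_iff] <;> tauto

theorem crosses_of_not_inc (H : FirstTriangle T a b c d i j k)
    {f : Fin (2 * n + 3)} (hf : Crosses T a b f) (hd : ¬ Inc T f d) :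
    Crosses T d b f := by
  simp only [Inc, Fin.ext_iff, not_or] at hd
  exact interlace_replace hf ((joins_ends f).not_interlace H.right) hd.1 hd.2

theorem precedes_iff (H : FirstTriangle T a b c d i j k)
    {e f : Fin (2 * n + 3)} (he : Crosses T d b e) :
    Precedes T a e f ↔ Precedes T d e f := by
  obtain ⟨-, ha, hd⟩ := H.crosses_of_crosses he
  simp only [Inc, Fin.ext_iff, not_or] at ha hd
  have h := beyond_congr ((joins_ends e).not_interlace H.right) ha.1 ha.2 hd.1 hd.2
  exact and_congr (h _) (h _)

theorem inc_of_precedes (H : FirstTriangle T a b c d i j k)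
    {e f : Fin (2 * n + 3)} (h : Precedes T a e f) (hf : Inc T f d) :
    Inc T e d := by
  have hB : Beyond (T.src e) (T.tgt e) a d := by
    rcases hf with h' | h'
    · rw [← h']; exact h.1
    · rw [← h']; exact h.2
  rcases hB with h' | h' | h'
  · exact Or.inl (Fin.ext h'.symm)
  · exact Or.inr (Fin.ext h'.symm)
  · exact absurd h' ((joins_ends e).not_interlace H.right)

theorem precedes_of_inc (H : FirstTriangle T a b c d i j k)
    {e f : Fin (2 * n + 3)} (he : Crosses T a b e) (hf : Crosses T a b f)
    (hed : Inc T e d) (hfd : ¬ Inc T f d) : Precedes T a e f :=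
  (precedes_total he hf).resolve_right fun h => hfd (H.inc_of_precedes h hed)

theorem crosses_base (H : FirstTriangle T a b c d i j k) :
    Crosses T a b k := H.base.crosses_iff.mpr H.interlace.symm

theorem not_crosses_left (H : FirstTriangle T a b c d i j k) : ¬ Crosses T a b i := by
  rw [H.left.crosses_iff]
  intro h
  exact h.ne.2.2.1 rfl

theorem eq_base_of_precedes (H : FirstTriangle T a b c d i j k)
    {f : Fin (2 * n + 3)} (h : Precedes T a f k) : f = k :=
  (joins_of_inc H.base.ne (H.swap.inc_of_precedes h H.base.inc_left)
    (H.inc_of_precedes h H.base.inc_right)).index_unique H.base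

theorem base_precedes (H : FirstTriangle T a b c d i j k)
    {f : Fin (2 * n + 3)} (hf : Crosses T a b f) (hne : f ≠ k) :
    Precedes T a k f :=
  (precedes_total H.crosses_base hf).resolve_right fun h => hne (H.eq_base_of_precedes h)

theorem not_inc_of_pairwise (H : FirstTriangle T a b c d i j k)
    {e : Fin (2 * n + 3)} {es : List (Fin (2 * n + 3))}
    (he : Crosses T a b e) (hd : ¬ Inc T e d) (hp : (e :: es).Pairwise (SeqRel T a b)) :
    ∀ f ∈ e :: es, Crosses T a b f → ¬ Inc T f d := by
  rw [List.forall_mem_cons]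
  refine ⟨fun _ => hd, fun f hf hc hfd => hd ?_⟩
  exact H.inc_of_precedes ((List.rel_of_pairwise_cons hp hf).2 he hc) hfd

theorem seqRel_of_seqRel (H : FirstTriangle T a b c d i j k)
    {e f : Fin (2 * n + 3)} (h : SeqRel T a b e f) : SeqRel T d b e f :=
  ⟨h.1, fun he hf => (H.precedes_iff he).mp
    (h.2 (H.crosses_of_crosses he).1 (H.crosses_of_crosses hf).1)⟩

theorem seqRel_of_not_inc (H : FirstTriangle T a b c d i j k)
    {e f : Fin (2 * n + 3)} (he : ¬ Inc T e d) (hf : ¬ Inc T f d)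
    (h : SeqRel T d b e f) : SeqRel T a b e f :=
  ⟨h.1, fun h1 h2 => (H.precedes_iff (H.crosses_of_not_inc h1 he)).mpr
    (h.2 (H.crosses_of_not_inc h1 he) (H.crosses_of_not_inc h2 hf))⟩

theorem pairwise_of_not_inc (H : FirstTriangle T a b c d i j k)
    {es : List (Fin (2 * n + 3))} (hd : ∀ e ∈ es, ¬ Inc T e d)
    (h : es.Pairwise (SeqRel T d b)) : es.Pairwise (SeqRel T a b) :=
  h.imp_of_mem fun he hf => H.seqRel_of_not_inc (hd _ he) (hd _ hf)

theorem not_inc_right (H : FirstTriangle T a b c d i j k)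
    {es : List (Fin (2 * n + 3))} {vs : List (Fin (n + 3))} {v : Fin (n + 3)}
    (h : IsWalk T (Crosses T d b) b false v vs es) : ∀ e ∈ es, ¬ Inc T e d :=
  h.not_inc (fun _ hf => (H.crosses_of_crosses hf).2.2) H.ne_bd (by simp)

theorem not_inc_apex (H : FirstTriangle T a b c d i j k)
    {es : List (Fin (2 * n + 3))} {vs : List (Fin (n + 3))} {v : Fin (n + 3)}
    (h : IsWalk T (Crosses T d b) b false v vs es) : ∀ e ∈ es, ¬ Inc T e a :=
  h.not_inc (fun _ hf => (H.crosses_of_crosses hf).2.1) H.ne_ab.symm (by simp)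

end FirstTriangle

/-- Turns a path starting at `d` into a path starting at `a` with first edge `T_i = ac`, where
`T_k = cd`. -/
def extendPath (a c : Fin (n + 3)) (i k : Fin (2 * n + 3)) (p : PathData n) : PathData n :=
  if p.2.head? = some k then (a :: p.1.tail, i :: p.2.tail) else (a :: c :: p.1, i :: k :: p.2)

/-- Inverse of `extendPath`. -/
def shortenPath (d : Fin (n + 3)) (k : Fin (2 * n + 3)) (p : PathData n) : PathData n :=
  if p.2[1]? = some k then (p.1.drop 2, p.2.drop 2) else (d :: p.1.tail, k :: p.2.tail)

namespace FirstTriangle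

variable {a b c d : Fin (n + 3)} {i j k : Fin (2 * n + 3)}

theorem ne_left_base (H : FirstTriangle T a b c d i j k) : i ≠ k := by
  rintro rfl
  exact H.ne_ad ((H.left.swap.eq_of_left H.base))

theorem mapsTo_extendPath (H : FirstTriangle T a b c d i j k) :
    Set.MapsTo (extendPath a c i k) (TPaths n T d b) (TPathsFirst n T a b i) := by
  rintro ⟨us, es⟩ hp
  rw [mem_TPaths_iff_seqRel H.ne_bd.symm] at hp
  obtain ⟨vs, rfl, hw, hp⟩ := hp
  simp only at hw hp
  match vs, es, hw, hp with
  | [], [], hw, _ => exact absurd hw.1 (by simp)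
  | v :: vs, e :: es, ⟨_, hj, hw⟩, hp =>
    have hd := H.not_inc_right hw
    have ha := H.not_inc_apex hw
    have hw' : IsWalk T (Crosses T a b) b false v vs es :=
      hw.imp fun f _ hf => (H.crosses_of_crosses hf).1
    rw [List.pairwise_cons] at hp
    have hp' := H.pairwise_of_not_inc hd hp.2
    have hi : ∀ f ∈ es, SeqRel T a b i f := fun f hf =>
      ⟨fun h => ha f hf (h ▸ H.left.inc_left), fun h => absurd h H.not_crosses_left⟩
    by_cases hek : e = k
    · subst hek
      obtain rfl : v = c := hj.eq_of_left H.base.swap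
      simp only [extendPath, List.head?_cons, if_true, List.tail_cons]
      refine ⟨(mem_TPaths_iff_seqRel H.ne_ab _).mpr ⟨v :: vs, rfl, ⟨by simp, H.left, hw'⟩, ?_⟩, rfl⟩
      exact List.pairwise_cons.mpr ⟨hi, hp'⟩
    · have h0 : ¬ ((e :: es).head? = some k) := by simpa using hek
      simp only [extendPath, if_neg h0]
      refine ⟨(mem_TPaths_iff_seqRel H.ne_ab _).mpr ⟨c :: d :: v :: vs, rfl,
        ⟨by simp, H.left, fun _ => H.crosses_base, H.base, by simp, hj, hw'⟩, ?_⟩, rfl⟩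
      have hie : i ≠ e := by
        rintro rfl
        have := H.left.inc_iff.mp hj.inc_left
        exact this.elim H.ne_ad.symm H.base.ne.symm
      refine List.pairwise_cons.mpr ⟨?_, List.pairwise_cons.mpr ⟨?_, List.pairwise_cons.mpr
        ⟨?_, hp'⟩⟩⟩
      · rw [List.forall_mem_cons, List.forall_mem_cons]
        exact ⟨⟨H.ne_left_base, fun h => absurd h H.not_crosses_left⟩,
          ⟨hie, fun h => absurd h H.not_crosses_left⟩, hi⟩
      · rw [List.forall_mem_cons]
        refine ⟨⟨Ne.symm hek, fun _ h => H.base_precedes h hek⟩, fun f hf => ?_⟩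
        have hfk : f ≠ k := fun h => hd f hf (h ▸ H.base.inc_right)
        exact ⟨hfk.symm, fun _ h => H.base_precedes h hfk⟩
      · intro f hf
        exact ⟨(hp.1 f hf).1, fun h1 h2 => H.precedes_of_inc h1 h2 hj.inc_left (hd f hf)⟩

theorem mapsTo_shortenPath (H : FirstTriangle T a b c d i j k) :
    Set.MapsTo (shortenPath d k) (TPathsFirst n T a b i) (TPaths n T d b) := by
  rintro ⟨us, es⟩ ⟨hp, hi⟩
  rw [mem_TPaths_iff_seqRel H.ne_ab] at hp
  obtain ⟨vs, rfl, hw, hp⟩ := hp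
  simp only at hw hp hi
  rw [mem_TPaths_iff_seqRel H.ne_bd.symm]
  match vs, es, hw, hp, hi with
  | [], [], hw, _, _ => exact absurd hw.1 (by simp)
  | v :: vs, e :: es, ⟨_, hj, hw⟩, hp, hi =>
    obtain rfl : e = i := by simpa using hi
    obtain rfl : v = c := hj.eq_of_left H.left
    match vs, es, hw, hp with
    | [], [], hw, _ => exact absurd hw.2.symm H.ne_bc
    | w :: vs, f :: es, ⟨hf, hj', hw⟩, hp =>
      have hf := hf rfl
      have hp1 := (List.pairwise_cons.mp hp).2
      have hp2 := (List.pairwise_cons.mp hp1).2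
      by_cases hfk : f = k
      · subst hfk
        obtain rfl : w = d := hj'.eq_of_left H.base
        have h0 : (e :: f :: es)[1]? = some f := rfl
        simp only [shortenPath, if_pos h0]
        refine ⟨vs, rfl, ?_, hp2.imp H.seqRel_of_seqRel⟩
        match vs, es, hw, hp2 with
        | [], [], hw, _ => exact absurd hw.1 (by simp)
        | x :: vs, g :: es, ⟨_, hj'', hw⟩, hp2 =>
          refine ⟨by simp, hj'', ?_⟩
          match vs, es, hw, hp2 with
          | [], [], hw, _ => exact hw
          | y :: vs, l :: es, hw, hp2 =>
            have hl := hw.1 rfl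
            have hld : ¬ Inc T l w := by
              intro h
              have hlx : Inc T l x := hw.2.1.inc_left
              have := (joins_of_inc hj''.ne h hlx).index_unique hj''
              exact (List.rel_of_pairwise_cons hp2 (List.mem_cons_self)).1 this.symm
            exact hw.imp fun g hg hc => H.crosses_of_not_inc hc
              (H.not_inc_of_pairwise hl hld (List.pairwise_cons.mp hp2).2 g hg hc)
      · have h0 : ¬ ((e :: f :: es)[1]? = some k) := by simpa using hfk
        simp only [shortenPath, if_neg h0, List.tail_cons]
        have hfd : ¬ Inc T f d := fun h =>
          hfk ((joins_of_inc H.base.ne hj'.inc_left h).index_unique H.base)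
        refine ⟨v :: w :: vs, rfl, ⟨by simp, H.base.swap, ?_⟩, List.pairwise_cons.mpr
          ⟨fun g hg => ?_, hp1.imp H.seqRel_of_seqRel⟩⟩
        · have hw' : IsWalk T (Crosses T a b) b false v (w :: vs) (f :: es) :=
            ⟨fun _ => hf, hj', hw⟩
          exact hw'.imp fun g hg hc =>
            H.crosses_of_not_inc hc (H.not_inc_of_pairwise hf hfd hp1 g hg hc)
        · refine ⟨?_, fun h => absurd H.base.inc_right (H.crosses_of_crosses h).2.2⟩
          rintro rfl
          rcases List.mem_cons.mp hg with h | h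
          · exact hfk h.symm
          · exact hfk (H.eq_base_of_precedes
              ((List.rel_of_pairwise_cons hp1 h).2 hf H.crosses_base))

theorem invOn_extendPath (H : FirstTriangle T a b c d i j k) :
    Set.InvOn (shortenPath d k) (extendPath a c i k) (TPaths n T d b) (TPathsFirst n T a b i) := by
  constructor
  · rintro ⟨us, es⟩ hp
    rw [mem_TPaths_iff_seqRel H.ne_bd.symm] at hp
    obtain ⟨vs, rfl, hw, hp⟩ := hp
    simp only at hw hp
    match vs, es, hw, hp with
    | [], [], hw, _ => exact absurd hw.1 (by simp)
    | v :: vs, e :: es, ⟨_, hj, hw⟩, hp =>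
      by_cases hek : e = k
      · subst hek
        obtain rfl : v = c := hj.eq_of_left H.base.swap
        have h0 : ¬ ((i :: es)[1]? = some e) := by
          intro h
          have : e ∈ es := List.mem_of_getElem? (i := 0) (by simpa using h)
          exact (List.rel_of_pairwise_cons hp this).1 rfl
        simp only [extendPath, List.head?_cons, if_true, List.tail_cons, shortenPath, if_neg h0]
      · have h0 : ¬ ((e :: es).head? = some k) := by simpa using hek
        have h1 : (i :: k :: e :: es)[1]? = some k := rfl
        simp only [extendPath, if_neg h0, shortenPath, if_pos h1]
        rfl
  · rintro ⟨us, es⟩ ⟨hp, hi⟩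
    rw [mem_TPaths_iff_seqRel H.ne_ab] at hp
    obtain ⟨vs, rfl, hw, hp⟩ := hp
    simp only at hw hp hi
    match vs, es, hw, hp, hi with
    | [], [], hw, _, _ => exact absurd hw.1 (by simp)
    | v :: vs, e :: es, ⟨_, hj, hw⟩, hp, hi =>
      obtain rfl : e = i := by simpa using hi
      obtain rfl : v = c := hj.eq_of_left H.left
      match vs, es, hw, hp with
      | [], [], hw, _ => exact absurd hw.2.symm H.ne_bc
      | w :: vs, f :: es, ⟨_, hj', hw⟩, hp =>
        have hp1 := (List.pairwise_cons.mp hp).2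
        by_cases hfk : f = k
        · subst hfk
          obtain rfl : w = d := hj'.eq_of_left H.base
          have h0 : (e :: f :: es)[1]? = some f := rfl
          have h1 : ¬ (es.head? = some f) := fun h =>
            (List.rel_of_pairwise_cons hp1 (List.mem_of_mem_head? h)).1 rfl
          simp only [shortenPath, if_pos h0, List.drop_succ_cons, List.drop_zero, extendPath,
            if_neg h1]
        · have h0 : ¬ ((e :: f :: es)[1]? = some k) := by simpa using hfk
          simp only [shortenPath, if_neg h0, List.tail_cons, extendPath, List.head?_cons, if_true]

theorem bijOn_extendPath (H : FirstTriangle T a b c d i j k) :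
    Set.BijOn (extendPath a c i k) (TPaths n T d b) (TPathsFirst n T a b i) :=
  H.invOn_extendPath.bijOn H.mapsTo_extendPath H.mapsTo_shortenPath

theorem TPaths_eq_union (H : FirstTriangle T a b c d i j k) :
    TPaths n T a b = TPathsFirst n T a b i ∪ TPathsFirst n T a b j := by
  refine Set.Subset.antisymm (fun p hp => ?_) (Set.union_subset (fun _ h => h.1) fun _ h => h.1)
  have hp' := hp
  obtain ⟨us, es⟩ := p
  rw [mem_TPaths_iff_seqRel H.ne_ab] at hp
  obtain ⟨vs, rfl, hw, -⟩ := hp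
  simp only at hw
  match vs, es, hw, hp' with
  | [], [], hw, _ => exact absurd hw.1 (by simp)
  | [v], [e], ⟨_, hj, _, hv⟩, hp' => exact absurd (hv ▸ hj) (H.not_joins e)
  | v :: w :: vs, e :: f :: es, ⟨_, hj, hf, hj', hw⟩, hp' =>
    have := eq_or_eq_of_first_triangle H.interlace (hj'.crosses_iff.mp (hf rfl))
      (hj'.not_interlace H.left) (hj'.not_interlace H.right) (hj.not_interlace H.base)
    rcases this with h | h
    · obtain rfl := Fin.ext h
      exact Or.inl ⟨hp', by simp [hj.index_unique H.left]⟩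
    · obtain rfl := Fin.ext h
      exact Or.inr ⟨hp', by simp [hj.index_unique H.right]⟩

theorem disjoint_TPathsFirst (H : FirstTriangle T a b c d i j k) :
    Disjoint (TPathsFirst n T a b i) (TPathsFirst n T a b j) := by
  rw [Set.disjoint_left]
  rintro p ⟨-, h1⟩ ⟨-, h2⟩
  obtain rfl : i = j := by simpa [h1] using h2
  exact H.base.ne (H.left.eq_of_left H.right)

theorem pathX_extendPath (H : FirstTriangle T a b c d i j k) (p : PathData n) :
    pathX n (extendPath a c i k p).2 = X n i / X n k * pathX n p.2 := by
  have hk := X_ne_zero k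
  unfold extendPath
  split_ifs with h
  · obtain ⟨us, es⟩ := p
    match es, h with
    | e :: es, h =>
      obtain rfl : e = k := by simpa using h
      simp only [List.tail_cons, pathX_cons]
      field_simp
  · simp only [pathX_cons, mul_inv, inv_inv]
    field_simp

theorem finsum_TPathsFirst (H : FirstTriangle T a b c d i j k) :
    ∑ᶠ α ∈ TPathsFirst n T a b i, pathX n α.2 =
    X n i / X n k * ∑ᶠ α ∈ TPaths n T d b, pathX n α.2 := by
  rw [mul_finsum_mem]
  exact (finsum_mem_eq_of_bijOn _ H.bijOn_extendPath
    fun p _ => (H.pathX_extendPath p).symm).symm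

theorem finsum_TPaths (H : FirstTriangle T a b c d i j k) : ∑ᶠ α ∈ TPaths n T a b, pathX n α.2 =
    X n i / X n k * ∑ᶠ α ∈ TPaths n T d b, pathX n α.2 +
      X n j / X n k * ∑ᶠ α ∈ TPaths n T c b, pathX n α.2 := by
  rw [H.TPaths_eq_union, finsum_mem_union H.disjoint_TPathsFirst
    ((finite_TPaths T a b).subset fun _ h => h.1) ((finite_TPaths T a b).subset fun _ h => h.1),
    H.finsum_TPathsFirst, H.swap.finsum_TPathsFirst]

theorem ncard_crosses_lt (H : FirstTriangle T a b c d i j k) :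
    {f | Crosses T d b f}.ncard < {f | Crosses T a b f}.ncard := by
  refine Set.ncard_lt_ncard ?_ (Set.toFinite _)
  have hsub : {f | Crosses T d b f} ⊆ {f | Crosses T a b f} :=
    fun f hf => (H.crosses_of_crosses hf).1
  exact (Set.ssubset_iff_of_subset hsub).mpr
    ⟨k, H.crosses_base, fun h => (H.crosses_of_crosses h).2.2 H.base.inc_right⟩

end FirstTriangle

theorem ordDet_of_joins {w : Fin (n + 3) → F n × F n}
    (hw : ∀ f u v, u < v → Joins n T f u v → det2 (w u) (w v) = X n f) {f : Fin (2 * n + 3)}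
    {u v : Fin (n + 3)} (h : Joins n T f u v) : ordDet w u v = X n f := by
  unfold ordDet
  split_ifs with huv
  · exact hw f u v huv h
  · exact hw f v u (lt_of_le_of_ne (not_lt.mp huv) h.ne.symm) h.swap

theorem finsum_TPaths_eq_ordDet {w : Fin (n + 3) → F n × F n}
    (hw : ∀ f u v, u < v → Joins n T f u v → det2 (w u) (w v) = X n f) {a b : Fin (n + 3)}
    (hab : a ≠ b) : ∑ᶠ α ∈ TPaths n T a b, pathX n α.2 = ordDet w a b := by
  induction hm : {f | Crosses T a b f}.ncard using Nat.strong_induction_on generalizing a with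
  | _ m ih =>
    subst hm
    by_cases hno : ∀ f, ¬ Joins n T f a b
    · obtain ⟨c, d, hI, ⟨i, hi⟩, ⟨j, hj⟩, ⟨k, hk⟩⟩ := exists_first_triangle hab hno
      have H : FirstTriangle T a b c d i j k := ⟨hI, hi, hj, hk⟩
      rw [H.finsum_TPaths, ih _ H.ncard_crosses_lt H.ne_bd.symm rfl,
        ih _ H.swap.ncard_crosses_lt H.ne_bc.symm rfl]
      have h := ordDet_ptolemy w hI
      rw [ordDet_of_joins hw hi, ordDet_of_joins hw hj, ordDet_of_joins hw hk] at h
      have hk0 := X_ne_zero k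
      field_simp
      linear_combination -h
    · push Not at hno
      obtain ⟨f, hf⟩ := hno
      rw [TPaths_edge hf, finsum_mem_singleton, ordDet_of_joins hw hf, pathX_cons]
      simp [pathX]

end Expansion

/-- Ptolemy relation for the sums `X_{u,v} = ∑_{α ∈ 𝒫_T(u,v)} x(α)`. -/
theorem sum_TPaths_ptolemy_relation
    (n : ℕ) (hn : 1 ≤ n) (T : Triangulation n) (p q r s : Fin (n + 3))
    (h : CyclicOrder4 n p q r s) :
    (∑ᶠ α ∈ TPaths n T p r, pathX n α.2) * (∑ᶠ α ∈ TPaths n T q s, pathX n α.2) =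
      (∑ᶠ α ∈ TPaths n T p q, pathX n α.2) * (∑ᶠ α ∈ TPaths n T r s, pathX n α.2) +
      (∑ᶠ α ∈ TPaths n T q r, pathX n α.2) * (∑ᶠ α ∈ TPaths n T p s, pathX n α.2) := by
  obtain ⟨w, hw⟩ := exists_vectors T
  have hI : Interlace p r q s := by
    unfold CyclicOrder4 at h
    unfold Interlace Inside Outside
    omega
  have hne : ∀ u v : Fin (n + 3), (u : ℕ) ≠ v → u ≠ v := fun u v h h' => h (by rw [h'])
  obtain ⟨h1, h2, h3, h4, h5, h6⟩ := hI.ne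
  have hsymm : ∀ u v, u ≠ v → ordDet w u v = ordDet w v u := by
    intro u v huv
    unfold ordDet
    rcases lt_or_gt_of_ne huv with h | h <;> simp [h, h.not_gt]
  rw [finsum_TPaths_eq_ordDet hw (hne _ _ h1), finsum_TPaths_eq_ordDet hw (hne _ _ h2),
    finsum_TPaths_eq_ordDet hw (hne _ _ h3), finsum_TPaths_eq_ordDet hw (hne _ _ h6),
    finsum_TPaths_eq_ordDet hw (hne _ _ h5.symm), finsum_TPaths_eq_ordDet hw (hne _ _ h4),
    ordDet_ptolemy w hI, hsymm s r (hne _ _ h6.symm)]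
  ring
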